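/- Let n ≥ 3, let a, b, c : ℤ → ℝ be n-periodic sequences, and let V : ℤ → ℝ³ be an n-periodic sequence of vectors satisfying V_{i+3} = a_i·V_{i+2} + b_i·V_{i+1} + c_i·V_i and det(V_i, V_{i+1}, V_{i+2}) ≠ 0 and c_i ≠ 0 for all i. For each i, let S_i : ℝ³ → ℝ³ be a linear map with S_i(V_{i+1}) = 0, S_i(V_{i+2}) = 0, and S_i(V_{i+3}) = −b_i·V_{i+1} − c_i·V_i. Then for every V ∈ ℝ³, ∑_{i=0}^{n-1} S_i(V) = −∑_{i=0}^{n-1} (det(V_{i-1}, V, V_{i+1})/det(V_{i-1}, V_i, V_{i+1}))·V_i. -/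

import Mathlib

/-- `det3 A B C` is the determinant of the 3×3 real matrix with columns `A`, `B`, `C`. -/
noncomputable def det3 (A B C : Fin 3 → ℝ) : ℝ := (Matrix.of ![A, B, C]).transpose.det

lemma det3_eq (A B C : Fin 3 → ℝ) :
    det3 A B C = A 0 * (B 1 * C 2 - B 2 * C 1) - A 1 * (B 0 * C 2 - B 2 * C 0) +
      A 2 * (B 0 * C 1 - B 1 * C 0) := by
  simp [det3, Matrix.det_fin_three]
  ring

/-- Cramer's rule for three vectors in `ℝ³`. -/
lemma det3_smul_eq (A B C W : Fin 3 → ℝ) :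
    det3 A B C • W = det3 W B C • A + det3 A W C • B + det3 A B W • C := by
  ext j
  fin_cases j <;> simp [det3_eq] <;> ring

/-- A linear map killing `A` and `B` is determined by its value at a third basis vector. -/
lemma map_eq_det3_div_smul {E : Type*} [AddCommGroup E] [Module ℝ E]
    (T : (Fin 3 → ℝ) →ₗ[ℝ] E) {A B C : Fin 3 → ℝ}
    (hA : T A = 0) (hB : T B = 0) (hD : det3 A B C ≠ 0) (W : Fin 3 → ℝ) :
    T W = (det3 A B W / det3 A B C) • T C := by
  have h := congrArg T (det3_smul_eq A B C W)
  simp only [map_add, map_smul, hA, hB, smul_zero, zero_add] at h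
  rw [div_eq_inv_mul, mul_smul, ← h, inv_smul_smul₀ hD]

/-- Summing the operators `Sᵢ` over one period gives (minus) Glick's operator minus the scalar
part: `∑ Sᵢ(V) = −∑ (det(V_{i-1}, V, V_{i+1})/det(V_{i-1}, V_i, V_{i+1}))·V_i`. -/
theorem sum_Si_eq_glick (n : ℕ) (hn : 3 ≤ n) (a b c : ℤ → ℝ)
    (ha : ∀ i : ℤ, a (i + n) = a i) (hb : ∀ i : ℤ, b (i + n) = b i)
    (hc : ∀ i : ℤ, c (i + n) = c i)
    (V : ℤ → Fin 3 → ℝ) (hVper : ∀ i : ℤ, V (i + n) = V i)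
    (hrec : ∀ i : ℤ, V (i + 3) = a i • V (i + 2) + b i • V (i + 1) + c i • V i)
    (hdet : ∀ i : ℤ, det3 (V i) (V (i + 1)) (V (i + 2)) ≠ 0)
    (hcne : ∀ i : ℤ, c i ≠ 0)
    (S : ℤ → (Fin 3 → ℝ) →ₗ[ℝ] (Fin 3 → ℝ))
    (hSX : ∀ i : ℤ, S i (V (i + 1)) = 0) (hSY : ∀ i : ℤ, S i (V (i + 2)) = 0)
    (hSZ : ∀ i : ℤ, S i (V (i + 3)) = -(b i • V (i + 1)) - c i • V i) :
    ∀ W : Fin 3 → ℝ,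
      ∑ i ∈ Finset.range n, S (i : ℤ) W =
        -∑ i ∈ Finset.range n,
          (det3 (V ((i : ℤ) - 1)) W (V ((i : ℤ) + 1)) /
            det3 (V ((i : ℤ) - 1)) (V (i : ℤ)) (V ((i : ℤ) + 1))) • V (i : ℤ) := by
  intro W
  set D : ℤ → ℝ := fun i => det3 (V i) (V (i + 1)) (V (i + 2)) with hD
  set L : ℤ → ℝ := fun i => det3 (V (i + 1)) (V (i + 2)) W with hL
  have hDsucc (i : ℤ) : D (i + 1) = c i * D i := by
    simp only [hD, show i + 1 + 1 = i + 2 by ring, show i + 1 + 2 = i + 3 by ring, hrec i,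
      det3_eq, Pi.add_apply, Pi.smul_apply, smul_eq_mul]
    ring
  have hLrec (i : ℤ) :
      L (i + 1) + b i * L i = c i * det3 (V i) W (V (i + 2)) := by
    simp only [hL, show i + 1 + 1 = i + 2 by ring, show i + 1 + 2 = i + 3 by ring, hrec i,
      det3_eq, Pi.add_apply, Pi.smul_apply, smul_eq_mul]
    ring
  have hS (i : ℤ) : S i W = -((L i / D i) • V i) - (b i * L i / D (i + 1)) • V (i + 1) := by
    have hDi : D i ≠ 0 := hdet i
    have hD' : det3 (V (i + 1)) (V (i + 2)) (V (i + 3)) = D (i + 1) := by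
      simp only [hD, show i + 1 + 1 = i + 2 by ring, show i + 1 + 2 = i + 3 by ring]
    have hne : D (i + 1) ≠ 0 := hdet (i + 1)
    rw [map_eq_det3_div_smul (S i) (hSX i) (hSY i) (by rwa [hD']) W, hSZ, hD',
      show L i / D i = L i / D (i + 1) * c i by
        rw [hDsucc]; field_simp [hcne i]]
    module
  let f : ℤ → Fin 3 → ℝ := fun i => (b (i - 1) * L (i - 1) / D i) • V i
  have hglick (i : ℤ) :
      S i W = -((det3 (V (i - 1)) W (V (i + 1)) / det3 (V (i - 1)) (V i) (V (i + 1))) • V i) -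
        (f (i + 1) - f i) := by
    have hDi : D i = c (i - 1) * D (i - 1) := by simpa using hDsucc (i - 1)
    have hD' : det3 (V (i - 1)) (V i) (V (i + 1)) = D (i - 1) := by
      simp only [hD, sub_add_cancel, show i - 1 + 2 = i + 1 by ring]
    have hLi : L i + b (i - 1) * L (i - 1) = c (i - 1) * det3 (V (i - 1)) W (V (i + 1)) := by
      simpa only [sub_add_cancel, show i - 1 + 2 = i + 1 by ring] using hLrec (i - 1)
    have hcoef : det3 (V (i - 1)) W (V (i + 1)) / D (i - 1) =
        L i / D i + b (i - 1) * L (i - 1) / D i := by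
      rw [← add_div, hLi, hDi, mul_div_mul_left _ _ (hcne _)]
    rw [hS, hD', hcoef]
    simp only [f, add_sub_cancel_right]
    module
  have hf : f n = f 0 := by
    have hb' : b ((n : ℤ) - 1) = b (0 - 1) := by
      rw [← hb (0 - 1), show (0 - 1 + n : ℤ) = n - 1 by ring]
    have hV' (k : ℤ) : V ((n : ℤ) + k) = V k := by rw [add_comm, hVper]
    have hV0 : V n = V 0 := by simpa using hV' 0
    have hD' : D n = D 0 := by simp only [hD, hV', hV0, zero_add]
    have hL' : L ((n : ℤ) - 1) = L (0 - 1) := by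
      simp only [hL, sub_eq_add_neg, add_assoc, hV', zero_add]
    simp only [f, hb', hD', hL', hV0]
  have htel : ∑ i ∈ Finset.range n, (f ((i : ℤ) + 1) - f i) = 0 := by
    have h := Finset.sum_range_sub (fun i : ℕ => f i) n
    simpa [hf] using h
  rw [Finset.sum_congr rfl fun (i : ℕ) _ => hglick i, Finset.sum_sub_distrib, htel, sub_zero,
    Finset.sum_neg_distrib]
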